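/- Suppose A ⊆ M^k is definable and open, and A_1, …, A_n are definable sets which cover A. Then some A_i has non-empty interior in A; in fact, almost every point of A lies in the interior of some A_i. -/

import Mathlib

/-! Common framework: dp-minimal structures with a definable uniform structure,
following "Dp-minimal structures equipped with definable uniformities". -/

namespace DpTame

open FirstOrder Set Cardinal

universe u

variable (L : FirstOrder.Language.{u, u}) (M : Type u) [L.Structure M]

/-- `A ⊆ M^α` is definable with parameters from `C ⊆ M`. -/
def DefSetP (C : Set M) {α : Type} (A : Set (α → M)) : Prop :=
  C.Definable L A

/-- `A ⊆ M^α` is definable (with parameters from `M`). -/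
def DefSet {α : Type} (A : Set (α → M)) : Prop :=
  (Set.univ : Set M).Definable L A

/-- A subset of `M` is definable (with parameters). -/
def DefSet1 (A : Set M) : Prop :=
  DefSet L M {v : Fin 1 → M | v 0 ∈ A}

/-- A definable relation between two tuple sorts, with parameters from `C`. -/
def DefRelP (C : Set M) {k l : ℕ} (G : Set ((Fin k → M) × (Fin l → M))) : Prop :=
  DefSetP L M C {v : (Fin k ⊕ Fin l) → M | (v ∘ Sum.inl, v ∘ Sum.inr) ∈ G}

/-- A definable relation between two tuple sorts, with parameters from `M`. -/
def DefRel {k l : ℕ} (G : Set ((Fin k → M) × (Fin l → M))) : Prop :=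
  DefRelP L M Set.univ G

/-- A definable subset of `M × M`. -/
def DefRel1 (G : Set (M × M)) : Prop :=
  DefSet L M {v : Fin 2 → M | (v 0, v 1) ∈ G}

/-- Model-theoretic algebraic closure of a parameter set `C ⊆ M`:
`a` lies in a finite `C`-definable set. -/
def aclOf (C : Set M) : Set M :=
  {a | ∃ S : Set (Fin 1 → M), C.Definable L S ∧ S.Finite ∧ (fun _ => a) ∈ S}

/-- The acl-dimension of a tuple over `C`: the minimal size of a subtuple over which (together
with `C`) the whole tuple is algebraic. -/
noncomputable def aclDimTuple (C : Set M) {k : ℕ} (a : Fin k → M) : ℕ :=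
  sInf {l | ∃ s : Finset (Fin k), s.card = l ∧ ∀ i, a i ∈ aclOf L M (C ∪ (a '' ↑s))}

open Classical in
/-- The acl-dimension of a set `A ⊆ M^k` defined over `C` (with `⊥` for the empty set). -/
noncomputable def aclDim (C : Set M) {k : ℕ} (A : Set (Fin k → M)) : WithBot ℕ :=
  if A = ∅ then ⊥ else ↑(sSup {l | ∃ a ∈ A, aclDimTuple L M C a = l})

/-- `A ⊆ M^k` has dp-rank greater than `n`: there are (definable-with-parameters) formulas
`φ_i(x,y)` for `i ≤ n` (coded as definable subsets of `M^k × M`) and infinite sets `B i ⊆ M`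
such that every choice from `∏ B i` is coded by an element of `A`. -/
def DpRankGt {k : ℕ} (A : Set (Fin k → M)) (n : ℕ) : Prop :=
  ∃ (Φ : Fin (n + 1) → Set ((Fin k ⊕ Fin 1) → M)) (B : Fin (n + 1) → Set M),
    (∀ i, DefSet L M (Φ i)) ∧ (∀ i, (B i).Infinite) ∧
    ∀ b : Fin (n + 1) → M, (∀ i, b i ∈ B i) →
      ∃ a ∈ A, ∀ i, ∀ y ∈ B i, (Sum.elim a (fun _ => y) ∈ Φ i ↔ y = b i)

open Classical in
/-- The dp-rank of a definable set, with `⊥` for the empty set. -/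
noncomputable def dpRank {k : ℕ} (A : Set (Fin k → M)) : WithBot ℕ :=
  if A = ∅ then ⊥ else ↑(sSup {m : ℕ | ∃ n, m = n + 1 ∧ DpRankGt L M A n})

/-- Dp-minimality (with respect to the home sort `M`): `M` does not have dp-rank greater
than one. -/
def DpMinimal : Prop :=
  ¬ DpRankGt L M (Set.univ : Set (Fin 1 → M)) 1

/-- `M` is NIP: no definable relation has the independence property. -/
def IsNIP : Prop :=
  ∀ (n m : ℕ) (Φ : Set ((Fin n ⊕ Fin m) → M)), DefSet L M Φ →
    ¬ ∃ (a : ℕ → Fin n → M) (b : Finset ℕ → Fin m → M),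
        ∀ (i : ℕ) (s : Finset ℕ), (Sum.elim (a i) (b s) ∈ Φ ↔ i ∈ s)

/-- Every finitely satisfiable collection of formulas in one variable over `C` is realized. -/
def RealizesTypesOver (C : Set M) : Prop :=
  ∀ p : Set ((L[[C]]).Formula (Fin 1)),
    (∀ s : Finset ((L[[C]]).Formula (Fin 1)), ↑s ⊆ p →
      ∃ a : M, ∀ φ ∈ s, φ.Realize (fun _ => a)) →
    ∃ a : M, ∀ φ ∈ p, φ.Realize (fun _ => a)

/-- `M` is `|L|⁺`-saturated. -/
def IsLPlusSaturated : Prop :=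
  ∀ C : Set M, #C ≤ L.card + ℵ₀ → RealizesTypesOver L M C

/-- Two tuples have the same type over `C`. -/
def SameTypeOver (C : Set M) {n : ℕ} (a b : Fin n → M) : Prop :=
  ∀ φ : (L[[C]]).Formula (Fin n), φ.Realize a ↔ φ.Realize b

/-- A sequence indexed by `ℕ` is indiscernible over `C`. -/
def IndiscernibleOver (C : Set M) (I : ℕ → M) : Prop :=
  ∀ (n : ℕ) (f g : Fin n → ℕ), StrictMono f → StrictMono g →
    SameTypeOver L M C (I ∘ f) (I ∘ g)

/-- The sequences `I l` are mutually indiscernible over `C`: each is indiscernible over `C`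
together with all of the other sequences. -/
def MutuallyIndiscernibleOver (C : Set M) {k : ℕ} (I : Fin k → ℕ → M) : Prop :=
  ∀ l : Fin k,
    IndiscernibleOver L M (C ∪ ⋃ m ∈ ({m : Fin k | m ≠ l} : Set (Fin k)), Set.range (I m)) (I l)

/-- A correspondence with domain `E ⊆ M^k`, values in `M^l`, definable over `C`: a definable
graph all of whose fibers over points of `E` are finite and nonempty. -/
def IsCorrP (C : Set M) {k l : ℕ} (E : Set (Fin k → M))
    (G : Set ((Fin k → M) × (Fin l → M))) : Prop :=
  DefRelP L M C G ∧ (∀ p ∈ G, p.1 ∈ E) ∧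
    ∀ x ∈ E, {y | (x, y) ∈ G}.Nonempty ∧ {y | (x, y) ∈ G}.Finite

/-- A correspondence, definable with arbitrary parameters. -/
def IsCorr {k l : ℕ} (E : Set (Fin k → M)) (G : Set ((Fin k → M) × (Fin l → M))) : Prop :=
  IsCorrP L M Set.univ E G

/-- An `m`-correspondence: every fiber has exactly `m` elements. -/
def IsMCorrP (C : Set M) {k l : ℕ} (E : Set (Fin k → M))
    (G : Set ((Fin k → M) × (Fin l → M))) (m : ℕ) : Prop :=
  IsCorrP L M C E G ∧ ∀ x ∈ E, {y | (x, y) ∈ G}.ncard = m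

/-- An `m`-correspondence definable with arbitrary parameters. -/
def IsMCorr {k l : ℕ} (E : Set (Fin k → M)) (G : Set ((Fin k → M) × (Fin l → M)))
    (m : ℕ) : Prop :=
  IsMCorrP L M Set.univ E G m

/-- A definable uniform structure on `M`: a definable basis of entourages
`{φ(M², c̄) : c̄ ∈ dom}` satisfying the axioms for a basis of a (Hausdorff) uniformity. -/
structure DefUniformBasis where
  n : ℕ
  dom : Set (Fin n → M)
  dom_nonempty : dom.Nonempty
  dom_def : DefSet L M dom
  phi : Set ((Fin 2 ⊕ Fin n) → M)
  phi_def : DefSet L M phi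
  symm : ∀ c ∈ dom, ∀ x y : M, Sum.elim ![x, y] c ∈ phi → Sum.elim ![y, x] c ∈ phi
  inter_eq_diag : ∀ x y : M, (∀ c ∈ dom, Sum.elim ![x, y] c ∈ phi) ↔ x = y
  directed : ∀ c ∈ dom, ∀ d ∈ dom, ∃ e ∈ dom, ∀ x y : M,
    Sum.elim ![x, y] e ∈ phi → Sum.elim ![x, y] c ∈ phi ∧ Sum.elim ![x, y] d ∈ phi
  comp : ∀ c ∈ dom, ∃ d ∈ dom, ∀ x y z : M,
    Sum.elim ![x, y] d ∈ phi → Sum.elim ![y, z] d ∈ phi → Sum.elim ![x, z] c ∈ phi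

namespace DefUniformBasis

variable {L M} (U : DefUniformBasis L M)

/-- The entourage with parameter `c`. -/
def ent (c : Fin U.n → M) : Set (M × M) :=
  {p | Sum.elim ![p.1, p.2] c ∈ U.phi}

/-- The ball of radius `c` around `x ∈ M`. -/
def ball (c : Fin U.n → M) (x : M) : Set M :=
  {y | (x, y) ∈ U.ent c}

/-- The ball of radius `c` around `x ∈ M^k` (product uniformity). -/
def ballk {k : ℕ} (c : Fin U.n → M) (x : Fin k → M) : Set (Fin k → M) :=
  {y | ∀ i, (x i, y i) ∈ U.ent c}

/-- Openness in `M` for the topology induced by the uniform structure. -/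
def IsOpen1 (A : Set M) : Prop :=
  ∀ x ∈ A, ∃ c ∈ U.dom, U.ball c x ⊆ A

/-- Interior in `M`. -/
def interior1 (A : Set M) : Set M :=
  {x | ∃ c ∈ U.dom, U.ball c x ⊆ A}

/-- Closure in `M`. -/
def closure1 (A : Set M) : Set M :=
  {x | ∀ c ∈ U.dom, (U.ball c x ∩ A).Nonempty}

/-- Openness in `M^k` for the product topology. -/
def IsOpenk {k : ℕ} (A : Set (Fin k → M)) : Prop :=
  ∀ x ∈ A, ∃ c ∈ U.dom, U.ballk c x ⊆ A

/-- Interior in `M^k`. -/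
def interiork {k : ℕ} (A : Set (Fin k → M)) : Set (Fin k → M) :=
  {x | ∃ c ∈ U.dom, U.ballk c x ⊆ A}

/-- Closure in `M^k`. -/
def closurek {k : ℕ} (A : Set (Fin k → M)) : Set (Fin k → M) :=
  {x | ∀ c ∈ U.dom, (U.ballk c x ∩ A).Nonempty}

/-- The frontier `∂A = cl(A) ∖ A`. -/
def frontierk {k : ℕ} (A : Set (Fin k → M)) : Set (Fin k → M) :=
  U.closurek A \ A

/-- Closedness in `M^k`. -/
def IsClosedk {k : ℕ} (A : Set (Fin k → M)) : Prop :=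
  U.closurek A ⊆ A

/-- `B` is dense in `A`. -/
def DenseIn {k : ℕ} (B A : Set (Fin k → M)) : Prop :=
  A ⊆ U.closurek B

/-- `A ⊆ M^k` is locally closed: every point of `A` has a (ball) neighborhood `W` such that
`A ∩ W` is closed in `W`. -/
def IsLocallyClosedk {k : ℕ} (A : Set (Fin k → M)) : Prop :=
  ∀ x ∈ A, ∃ c ∈ U.dom, U.ballk c x ∩ U.closurek (A ∩ U.ballk c x) ⊆ A

open Classical in
/-- The naive topological dimension of `A ⊆ M^k`: the largest `l` such that some coordinate
projection of `A` to `M^l` has nonempty interior (`⊥` for the empty set). -/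
noncomputable def topDim {k : ℕ} (A : Set (Fin k → M)) : WithBot ℕ :=
  if A = ∅ then ⊥ else
    ↑(sSup {l : ℕ | ∃ σ : Fin l → Fin k, Function.Injective σ ∧
        (U.interiork ((fun v => v ∘ σ) '' A)).Nonempty})

/-- Continuity of a correspondence with domain `E` and graph `G` at a point `x ∈ E`. -/
def CorrContAt {k l : ℕ} (E : Set (Fin k → M)) (G : Set ((Fin k → M) × (Fin l → M)))
    (x : Fin k → M) : Prop :=
  ∀ c ∈ U.dom, ∃ d ∈ U.dom, ∀ x' ∈ E, x' ∈ U.ballk d x →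
    (∀ y, (x, y) ∈ G → ∃ y', (x', y') ∈ G ∧ ∀ j, (y j, y' j) ∈ U.ent c) ∧
    (∀ y', (x', y') ∈ G → ∃ y, (x, y) ∈ G ∧ ∀ j, (y j, y' j) ∈ U.ent c)

/-- Continuity of a correspondence at every point of its domain. -/
def CorrContOn {k l : ℕ} (E : Set (Fin k → M)) (G : Set ((Fin k → M) × (Fin l → M))) : Prop :=
  ∀ x ∈ E, U.CorrContAt E G x

/-- Continuity of a function `M^k → M^l` on a set `V` (relative topology). -/
def ContOn {k l : ℕ} (f : (Fin k → M) → (Fin l → M)) (V : Set (Fin k → M)) : Prop :=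
  ∀ x ∈ V, ∀ c ∈ U.dom, ∃ d ∈ U.dom, ∀ y ∈ V, y ∈ U.ballk d x → f y ∈ U.ballk c (f x)

/-- `f` restricted to `V` is a homeomorphism onto its image. -/
def HomeoOnto {k l : ℕ} (f : (Fin k → M) → (Fin l → M)) (V : Set (Fin k → M)) : Prop :=
  Set.InjOn f V ∧ U.ContOn f V ∧
    ∀ x ∈ V, ∀ c ∈ U.dom, ∃ d ∈ U.dom, ∀ y ∈ V, f y ∈ U.ballk d (f x) → y ∈ U.ballk c x

/-- Continuity of a function `M → M` on a set `V`. -/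
def Cont1On (f : M → M) (V : Set M) : Prop :=
  ∀ x ∈ V, ∀ c ∈ U.dom, ∃ d ∈ U.dom, ∀ y ∈ V, y ∈ U.ball d x → f y ∈ U.ball c (f x)

/-- `f : M → M` restricted to `V` is a homeomorphism onto its image. -/
def Homeo1Onto (f : M → M) (V : Set M) : Prop :=
  Set.InjOn f V ∧ U.Cont1On f V ∧
    ∀ x ∈ V, ∀ c ∈ U.dom, ∃ d ∈ U.dom, ∀ y ∈ V, f y ∈ U.ball d (f x) → y ∈ U.ball c x

end DefUniformBasis

/-- The standing assumptions of the paper: `M` is an infinite `|L|⁺`-saturated NIP dp-minimal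
structure carrying a definable uniform structure whose topology has no isolated points and in
which every infinite definable subset of `M` has nonempty interior (Inf). -/
structure Setting extends DefUniformBasis L M where
  nonempty : Nonempty M
  saturated : IsLPlusSaturated L M
  nip : IsNIP L M
  dpMin : DpMinimal L M
  noIsolated : ∀ x : M, ∀ c ∈ toDefUniformBasis.dom, ∃ y, y ≠ x ∧
    y ∈ toDefUniformBasis.ball c x
  infInterior : ∀ A : Set M, DefSet1 L M A → A.Infinite →
    (toDefUniformBasis.interior1 A).Nonempty

end DpTame

namespace DpTame

open FirstOrder Set Cardinal

universe u

variable {L : FirstOrder.Language.{u, u}} {M : Type u} [L.Structure M]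

open DefUniformBasis

/-- `ℵ₀`-saturation in one variable, for decreasing sequences of definable sets. -/
theorem IsLPlusSaturated.exists_forall_mem_of_antitone (hs : IsLPlusSaturated L M)
    {X : ℕ → Set (Fin 1 → M)} (hX : ∀ N, DefSet L M (X N)) (hanti : Antitone X)
    (hne : ∀ N, (X N).Nonempty) : ∃ a, ∀ N, a ∈ X N := by
  classical
  choose C _ hC using fun N => Set.definable_iff_finitely_definable.1 (hX N)
  let D : Set M := ⋃ N, (C N : Set M)
  have hD : ∀ N, D.Definable L (X N) := fun N =>
    (hC N).mono (Set.subset_iUnion (fun N => (C N : Set M)) N)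
  have hcount : D.Countable := Set.countable_iUnion fun N => (C N).countable_toSet
  choose φ hφ using hD
  have hmem : ∀ N (a : Fin 1 → M), a ∈ X N ↔ (φ N).Realize a := fun N a => by
    conv_lhs => rw [hφ N]
    rfl
  obtain ⟨a, ha⟩ := hs D (hcount.le_aleph0.trans le_add_self) (Set.range φ) (by
    intro s hsub
    have : ∃ N, ∀ ψ ∈ s, ∃ m ≤ N, φ m = ψ := by
      choose! g hg using fun (ψ : (L[[D]]).Formula (Fin 1)) (h : ψ ∈ s) => hsub h
      exact ⟨s.sup g, fun ψ h => ⟨g ψ, Finset.le_sup h, hg ψ h⟩⟩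
    obtain ⟨N, hN⟩ := this
    obtain ⟨a, ha⟩ := hne N
    refine ⟨a 0, fun ψ h => ?_⟩
    obtain ⟨m, hm, rfl⟩ := hN ψ h
    have : a = fun _ => a 0 := by
      ext i
      rw [Subsingleton.elim i 0]
    rw [← this, ← hmem]
    exact hanti hm ha)
  exact ⟨fun _ => a, fun N => (hmem N _).2 (ha _ ⟨N, rfl⟩)⟩

theorem definableFun_var {α : Type} (i : α) :
    (Set.univ : Set M).DefinableFun L (fun v : α → M => v i) :=
  Set.DefinableFun.proj L

theorem definableFun_const {α : Type} (a : M) :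
    (Set.univ : Set M).DefinableFun L (fun _ : α → M => a) :=
  L.definableFun_const α (Set.mem_univ a)

/-- `ℵ₀`-saturation in finitely many variables, for decreasing sequences of definable sets. -/
theorem IsLPlusSaturated.exists_forall_mem_of_antitone_fin (hs : IsLPlusSaturated L M) :
    ∀ (m : ℕ) {X : ℕ → Set (Fin m → M)}, (∀ N, DefSet L M (X N)) → Antitone X →
      (∀ N, (X N).Nonempty) → ∃ a, ∀ N, a ∈ X N
  | 0, X, _, _, hne => ⟨Fin.elim0, fun N => by
      obtain ⟨a, ha⟩ := hne N
      rwa [Subsingleton.elim a Fin.elim0] at ha⟩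
  | m + 1, X, hX, hanti, hne => by
    obtain ⟨a, ha⟩ := hs.exists_forall_mem_of_antitone_fin m
      (X := fun N => (fun v : Fin (m + 1) → M => v ∘ Fin.succ) '' X N)
      (fun N => (hX N).image_comp Fin.succ) (fun _ _ h => Set.image_mono (hanti h))
      (fun N => (hne N).image _)
    obtain ⟨b, hb⟩ := hs.exists_forall_mem_of_antitone
      (X := fun N => (fun v : Fin 1 → M => (Fin.cons (v 0) a : Fin (m + 1) → M)) ⁻¹' X N)
      (fun N => (hX N).preimage_map (Fin.cases (definableFun_var 0) fun i =>
        definableFun_const (a i)))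
      (fun _ _ h => Set.preimage_mono (hanti h))
      (fun N => by
        obtain ⟨v, hv, rfl⟩ := ha N
        refine ⟨fun _ => v 0, ?_⟩
        simpa only [Set.mem_preimage, show (Fin.cons (v 0) (v ∘ Fin.succ) : Fin (m + 1) → M) = v
          from Fin.cons_self_tail v] using hv)
    exact ⟨_, hb⟩

theorem IsLPlusSaturated.exists_forall_mem_of_antitone_finite (hs : IsLPlusSaturated L M)
    {α : Type} [Finite α] {X : ℕ → Set (α → M)} (hX : ∀ N, DefSet L M (X N))
    (hanti : Antitone X) (hne : ∀ N, (X N).Nonempty) : ∃ a, ∀ N, a ∈ X N := by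
  obtain ⟨m, ⟨e⟩⟩ := Finite.exists_equiv_fin α
  obtain ⟨a, ha⟩ := hs.exists_forall_mem_of_antitone_fin m
    (X := fun N => (fun v : Fin m → M => v ∘ e) ⁻¹' X N)
    (fun N => (hX N).preimage_comp e) (fun _ _ h => Set.preimage_mono (hanti h))
    (fun N => by
      obtain ⟨v, hv⟩ := hne N
      exact ⟨v ∘ e.symm, by simpa [Function.comp_assoc] using hv⟩)
  exact ⟨_, ha⟩

namespace DefUniformBasis

variable (U : DefUniformBasis L M)

theorem mem_ball_self {c : Fin U.n → M} (hc : c ∈ U.dom) (x : M) : x ∈ U.ball c x :=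
  (U.inter_eq_diag x x).2 rfl c hc

theorem mem_ballk_self {k : ℕ} {c : Fin U.n → M} (hc : c ∈ U.dom) (x : Fin k → M) :
    x ∈ U.ballk c x :=
  fun i => U.mem_ball_self hc (x i)

theorem interiork_mono {k : ℕ} {A B : Set (Fin k → M)} (h : A ⊆ B) :
    U.interiork A ⊆ U.interiork B :=
  fun _ ⟨c, hc, hA⟩ => ⟨c, hc, hA.trans h⟩

theorem interiork_subset {k : ℕ} (A : Set (Fin k → M)) : U.interiork A ⊆ A :=
  fun x ⟨_, hc, hA⟩ => hA (U.mem_ballk_self hc x)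

theorem defSet_ballk {k : ℕ} (c : Fin U.n → M) (x : Fin k → M) :
    DefSet L M (U.ballk c x) := by
  have h : ∀ i, DefSet L M {y : Fin k → M | Sum.elim ![x i, y i] c ∈ U.phi} := fun i =>
    U.phi_def.preimage_map (F := fun y : Fin k → M => Sum.elim ![x i, y i] c) (by
      rintro (j | j)
      · fin_cases j
        · exact definableFun_const (x i)
        · exact definableFun_var i
      · exact definableFun_const (c j))
  have := Set.definable_iInter_of_finite h
  rwa [← Set.ofPred_forall] at this

/-- A ball can be shrunk so as to avoid any finite set, except for its centre. -/
theorem exists_ball_subset_inter_subset {F : Set M} (hF : F.Finite) (x : M)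
    {c : Fin U.n → M} (hc : c ∈ U.dom) :
    ∃ e ∈ U.dom, U.ball e x ⊆ U.ball c x ∧ U.ball e x ∩ F ⊆ {x} := by
  induction F, hF using Set.Finite.induction_on with
  | empty => exact ⟨c, hc, subset_rfl, by simp⟩
  | @insert y F _ _ ih =>
    obtain ⟨e, he, hec, heF⟩ := ih
    by_cases hxy : x = y
    · exact ⟨e, he, hec, by rw [← hxy]; rintro z ⟨hz, rfl | hzF⟩; exacts [rfl, heF ⟨hz, hzF⟩]⟩
    · obtain ⟨d, hd, hdxy⟩ : ∃ d ∈ U.dom, Sum.elim ![x, y] d ∉ U.phi := by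
        by_contra! h
        exact hxy ((U.inter_eq_diag x y).1 h)
      obtain ⟨f, hf, hfe⟩ := U.directed e he d hd
      refine ⟨f, hf, fun z hz => hec (hfe x z hz).1, ?_⟩
      rintro z ⟨hz, rfl | hzF⟩
      · exact absurd (hfe x z hz).2 hdxy
      · exact heF ⟨(hfe x z hz).1, hzF⟩

/-- Pairs `(b, c)` such that the `c`-ball around `b` is contained in at least `N` of the fibers
of `A` over its first coordinate. -/
def commonBall {k : ℕ} (A : Set (Fin (k + 1) → M)) (N : ℕ) : Set (Fin k ⊕ Fin U.n → M) :=
  {w | w ∘ Sum.inr ∈ U.dom ∧ ∃ x : Fin N → M, Function.Injective x ∧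
    ∀ j, ∀ v ∈ U.ballk (w ∘ Sum.inr) (w ∘ Sum.inl), (Fin.cons (x j) v : Fin (k + 1) → M) ∈ A}

theorem commonBall_antitone {k : ℕ} (A : Set (Fin (k + 1) → M)) : Antitone (U.commonBall A) := by
  rintro m N hmN w ⟨hw, x, hx, hA⟩
  exact ⟨hw, x ∘ Fin.castLE hmN, hx.comp (Fin.castLE_injective hmN), fun j => hA _⟩

/-- The pairs `(b, c)` together with a point `x` over which the fiber of `A` contains the
`c`-ball around `b`. -/
theorem defSet_ballk_subset_fiber {k : ℕ} {A : Set (Fin (k + 1) → M)} (hA : DefSet L M A) :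
    DefSet L M {w : (Fin k ⊕ Fin U.n) ⊕ Fin 1 → M |
      ∀ v ∈ U.ballk (w ∘ Sum.inl ∘ Sum.inr) (w ∘ Sum.inl ∘ Sum.inl),
        (Fin.cons (w (Sum.inr 0)) v : Fin (k + 1) → M) ∈ A} := by
  have h₁ : DefSet L M {u : ((Fin k ⊕ Fin U.n) ⊕ Fin 1) ⊕ Fin k → M | ∀ i,
      Sum.elim ![u (Sum.inl (Sum.inl (Sum.inl i))), u (Sum.inr i)]
        (fun j => u (Sum.inl (Sum.inl (Sum.inr j)))) ∈ U.phi} := by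
    rw [Set.ofPred_forall]
    refine Set.definable_iInter_of_finite fun i => U.phi_def.preimage_map (F := fun u =>
      Sum.elim ![u (Sum.inl (Sum.inl (Sum.inl i))), u (Sum.inr i)]
        (fun j => u (Sum.inl (Sum.inl (Sum.inr j))))) ?_
    rintro (j | j)
    · fin_cases j
      · exact definableFun_var _
      · exact definableFun_var _
    · exact definableFun_var _
  have h₂ : DefSet L M {u : ((Fin k ⊕ Fin U.n) ⊕ Fin 1) ⊕ Fin k → M |
      (Fin.cons (u (Sum.inl (Sum.inr 0))) (u ∘ Sum.inr) : Fin (k + 1) → M) ∈ A} :=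
    hA.preimage_map (F := fun u : ((Fin k ⊕ Fin U.n) ⊕ Fin 1) ⊕ Fin k → M =>
      Fin.cons (u (Sum.inl (Sum.inr 0))) (u ∘ Sum.inr))
      (Fin.cases (definableFun_var _) fun i => definableFun_var _)
  have h := (h₁.compl.union h₂).forall_of_finite
  refine (congrArg _ (Set.ext fun w => forall_congr' fun v => ?_)).mp h
  exact imp_iff_not_or.symm

theorem defSet_commonBall {k : ℕ} {A : Set (Fin (k + 1) → M)} (hA : DefSet L M A) (N : ℕ) :
    DefSet L M (U.commonBall A N) := by
  have hinj : DefSet L M {u : (Fin k ⊕ Fin U.n) ⊕ Fin N → M |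
      Function.Injective (u ∘ Sum.inr)} := by
    have h : DefSet L M {u : (Fin k ⊕ Fin U.n) ⊕ Fin N → M |
        ∀ p : {p : Fin N × Fin N // p.1 ≠ p.2}, u (Sum.inr p.1.1) ≠ u (Sum.inr p.1.2)} := by
      rw [Set.ofPred_forall]
      exact Set.definable_iInter_of_finite fun p =>
        (Set.DefinableFun.ofPred_eq (definableFun_var _)
          (definableFun_var _)).compl
    refine (congrArg _ (Set.ext fun u => ?_)).mp h
    exact ⟨fun h i j hij => by_contra fun hne => h ⟨(i, j), hne⟩ hij,
      fun h p hp => p.2 (h hp)⟩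
  have hball : DefSet L M {u : (Fin k ⊕ Fin U.n) ⊕ Fin N → M | ∀ j,
      ∀ v ∈ U.ballk (u ∘ Sum.inl ∘ Sum.inr) (u ∘ Sum.inl ∘ Sum.inl),
        (Fin.cons (u (Sum.inr j)) v : Fin (k + 1) → M) ∈ A} := by
    rw [Set.ofPred_forall]
    exact Set.definable_iInter_of_finite fun j =>
      (U.defSet_ballk_subset_fiber hA).preimage_comp (Sum.map id fun _ => j)
  exact (U.dom_def.preimage_comp Sum.inr).inter (hinj.inter hball).exists_of_finite

end DefUniformBasis

namespace Setting

variable (S : Setting L M)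

theorem infinite_ball {c : Fin S.n → M} (hc : c ∈ S.dom) (x : M) :
    (S.ball c x).Infinite := by
  intro hfin
  obtain ⟨e, he, hec, hsub⟩ := S.exists_ball_subset_inter_subset hfin x hc
  obtain ⟨y, hyx, hy⟩ := S.noIsolated x e he
  exact hyx (hsub ⟨hy, hec hy⟩)

/-- A definable set has nonempty interior as soon as, for every `N`, some `N` of its fibers over
the first coordinate contain a common ball. -/
theorem interiork_nonempty_of_commonBall {k : ℕ} {A : Set (Fin (k + 1) → M)}
    (hA : DefSet L M A) (h : ∀ N, (S.commonBall A N).Nonempty) : (S.interiork A).Nonempty := by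
  obtain ⟨w, hw⟩ := S.saturated.exists_forall_mem_of_antitone_finite
    (S.defSet_commonBall hA) (S.commonBall_antitone A) h
  let c := w ∘ Sum.inr
  have hc : c ∈ S.dom := (hw 0).1
  let X : Set M := {x | ∀ v ∈ S.ballk c (w ∘ Sum.inl), (Fin.cons x v : Fin (k + 1) → M) ∈ A}
  have hXdef : DefSet1 L M X :=
    (S.defSet_ballk_subset_fiber hA).preimage_map (F := fun u : Fin 1 → M => Sum.elim w u) (by
      rintro (j | j)
      · exact definableFun_const (w j)
      · exact definableFun_var j)
  have hXinf : X.Infinite := by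
    intro hfin
    obtain ⟨-, x, hx, hxA⟩ := hw (X.ncard + 1)
    have hle := Set.ncard_le_ncard (Set.range_subset_iff.2 hxA : Set.range x ⊆ X) hfin
    rw [Set.ncard_range_of_injective hx, Nat.card_fin] at hle
    omega
  obtain ⟨x, d, hd, hx⟩ := S.infInterior X hXdef hXinf
  obtain ⟨e, he, hecd⟩ := S.directed c hc d hd
  refine ⟨Fin.cons x (w ∘ Sum.inl), e, he, fun y hy => ?_⟩
  rw [← Fin.cons_self_tail y]
  exact hx (hecd _ _ (hy 0)).2 _ fun i => (hecd _ _ (hy i.succ)).1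

/-- If all the fibers of `A ∪ B` over a finite set `F` contain a common definable set with
nonempty interior, then `F` splits into two parts for which the corresponding fibers of `A`, and
of `B`, contain a common definable set with nonempty interior. -/
theorem exists_split {k : ℕ}
    (ih : ∀ A B : Set (Fin k → M), DefSet L M A → DefSet L M B →
      (S.interiork (A ∪ B)).Nonempty → (S.interiork A).Nonempty ∨ (S.interiork B).Nonempty)
    {A B : Set (Fin (k + 1) → M)} (hA : DefSet L M A) (hB : DefSet L M B)
    {V : Set (Fin k → M)} (hV : DefSet L M V) (hVint : (S.interiork V).Nonempty) (F : Finset M)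
    (hF : ∀ x ∈ F, ∀ v ∈ V, (Fin.cons x v : Fin (k + 1) → M) ∈ A ∪ B) :
    ∃ s t : Finset M, F.card ≤ s.card + t.card ∧ ∃ W ⊆ V, DefSet L M W ∧
      (S.interiork W).Nonempty ∧
      (∀ x ∈ s, ∀ v ∈ W, (Fin.cons x v : Fin (k + 1) → M) ∈ A) ∧
      ∀ x ∈ t, ∀ v ∈ W, (Fin.cons x v : Fin (k + 1) → M) ∈ B := by
  classical
  have hfiber : ∀ {C : Set (Fin (k + 1) → M)}, DefSet L M C → ∀ x : M,
      DefSet L M {v : Fin k → M | (Fin.cons x v : Fin (k + 1) → M) ∈ C} := fun hC x =>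
    hC.preimage_map (F := fun v : Fin k → M => (Fin.cons x v : Fin (k + 1) → M))
      (Fin.cases (definableFun_const x) fun i => definableFun_var i)
  suffices h : ∃ s t : Finset M, F ⊆ s ∪ t ∧ ∃ W ⊆ V, DefSet L M W ∧
      (S.interiork W).Nonempty ∧
      (∀ x ∈ s, ∀ v ∈ W, (Fin.cons x v : Fin (k + 1) → M) ∈ A) ∧
      ∀ x ∈ t, ∀ v ∈ W, (Fin.cons x v : Fin (k + 1) → M) ∈ B by
    obtain ⟨s, t, hst, h⟩ := h
    exact ⟨s, t, (Finset.card_le_card hst).trans (Finset.card_union_le s t), h⟩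
  induction F using Finset.induction_on with
  | empty => exact ⟨∅, ∅, by simp, V, subset_rfl, hV, hVint, by simp, by simp⟩
  | insert x F _ ihF =>
    obtain ⟨s, t, hst, W, hWV, hW, hWint, hs, ht⟩ :=
      ihF fun y hy => hF y (Finset.mem_insert_of_mem hy)
    have hWA := hW.inter (hfiber hA x)
    have hWB := hW.inter (hfiber hB x)
    rcases ih _ _ hWA hWB (hWint.mono (S.interiork_mono fun v hv =>
      (hF x (Finset.mem_insert_self x F) v (hWV hv)).imp (⟨hv, ·⟩) (⟨hv, ·⟩))) with h | h
    · refine ⟨insert x s, t, ?_, _, Set.inter_subset_left.trans hWV, hWA, h, ?_,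
        fun y hy v hv => ht y hy v hv.1⟩
      · rw [Finset.insert_union]
        exact Finset.insert_subset_insert x hst
      · intro y hy v hv
        rcases Finset.mem_insert.1 hy with rfl | hy
        exacts [hv.2, hs y hy v hv.1]
    · refine ⟨s, insert x t, ?_, _, Set.inter_subset_left.trans hWV, hWB, h,
        fun y hy v hv => hs y hy v hv.1, ?_⟩
      · rw [Finset.union_insert]
        exact Finset.insert_subset_insert x hst
      · intro y hy v hv
        rcases Finset.mem_insert.1 hy with rfl | hy
        exacts [hv.2, ht y hy v hv.1]

theorem commonBall_nonempty {k N : ℕ} {A : Set (Fin (k + 1) → M)} {W : Set (Fin k → M)}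
    (hW : (S.interiork W).Nonempty) {s : Finset M} (hN : N ≤ s.card)
    (hs : ∀ x ∈ s, ∀ v ∈ W, (Fin.cons x v : Fin (k + 1) → M) ∈ A) :
    (S.commonBall A N).Nonempty := by
  obtain ⟨b, c, hc, hbW⟩ := hW
  refine ⟨Sum.elim b c, hc, fun j => (s.equivFin.symm (Fin.castLE hN j) : M), ?_, ?_⟩
  · exact Subtype.val_injective.comp
      (s.equivFin.symm.injective.comp (Fin.castLE_injective hN))
  · exact fun j v hv => hs _ (Subtype.prop _) v (hbW hv)

theorem interiork_nonempty_or {k : ℕ} : ∀ (A B : Set (Fin k → M)), DefSet L M A →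
    DefSet L M B → (S.interiork (A ∪ B)).Nonempty →
    (S.interiork A).Nonempty ∨ (S.interiork B).Nonempty := by
  induction k with
  | zero =>
    intro A B _ _ ⟨p, hp⟩
    obtain ⟨c, hc⟩ := S.dom_nonempty
    have key : ∀ C : Set (Fin 0 → M), p ∈ C → (S.interiork C).Nonempty := fun C hC =>
      ⟨p, c, hc, fun y _ => by rwa [Subsingleton.elim y p]⟩
    exact (S.interiork_subset _ hp).imp (key A) (key B)
  | succ k ih =>
    intro A B hA hB ⟨p, c, hc, hp⟩
    have key : ∀ N, (S.commonBall A N).Nonempty ∨ (S.commonBall B N).Nonempty := by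
      intro N
      obtain ⟨F, hF, hcard⟩ := (S.infinite_ball hc (p 0)).exists_subset_card_eq (2 * N)
      obtain ⟨s, t, hst, W, -, -, hWint, hs, ht⟩ := S.exists_split ih hA hB
        (S.defSet_ballk c (Fin.tail p)) ⟨_, c, hc, subset_rfl⟩ F
        fun x hx v hv => hp (Fin.cases (hF hx) hv)
      rcases (by omega : N ≤ s.card ∨ N ≤ t.card) with h | h
      exacts [Or.inl (S.commonBall_nonempty hWint h hs),
        Or.inr (S.commonBall_nonempty hWint h ht)]
    by_cases h : ∀ N, (S.commonBall A N).Nonempty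
    · exact Or.inl (S.interiork_nonempty_of_commonBall hA h)
    · push Not at h
      obtain ⟨N₀, hN₀⟩ := h
      refine Or.inr (S.interiork_nonempty_of_commonBall hB fun N => ?_)
      have hmax := (key (max N N₀)).resolve_left fun h' => by
        have := h'.mono (S.commonBall_antitone A (le_max_right N N₀))
        simp [hN₀] at this
      exact hmax.mono (S.commonBall_antitone B (le_max_left N N₀))

/-- If a definable set with nonempty interior is covered by finitely many definable sets, then
one of them has nonempty interior in it. -/
theorem exists_interiork_inter_nonempty {k n : ℕ} {X : Set (Fin k → M)} (hX : DefSet L M X)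
    (hXint : (S.interiork X).Nonempty) {P : Fin n → Set (Fin k → M)}
    (hP : ∀ i, DefSet L M (P i)) (hcover : X ⊆ ⋃ i, P i) :
    ∃ i, (S.interiork (P i ∩ X)).Nonempty := by
  induction n generalizing X with
  | zero =>
    obtain ⟨p, hp⟩ := hXint
    obtain ⟨i, -⟩ := Set.mem_iUnion.1 (hcover (S.interiork_subset X hp))
    exact i.elim0
  | succ n ih =>
    have hdiff : DefSet L M (X \ P 0) := hX.sdiff (hP 0)
    rcases S.interiork_nonempty_or _ _ ((hP 0).inter hX) hdiff
      (hXint.mono (S.interiork_mono fun x hx =>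
        (em (x ∈ P 0)).imp (⟨·, hx⟩) (⟨hx, ·⟩))) with h | h
    · exact ⟨0, h⟩
    · obtain ⟨i, hi⟩ := ih hdiff h (P := fun i => P i.succ) (fun i => hP i.succ) fun x hx => by
        obtain ⟨i, hi⟩ := Set.mem_iUnion.1 (hcover hx.1)
        refine Set.mem_iUnion.2 (Fin.cases (fun h0 => absurd h0 hx.2) (fun j hj => ⟨j, hj⟩) i hi)
      exact ⟨i.succ, hi.mono (S.interiork_mono (Set.inter_subset_inter_right _
        Set.sdiff_subset))⟩

end Setting

namespace DefUniformBasis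

variable (U : DefUniformBasis L M)

theorem interiork_nonempty_of_image_comp {k : ℕ} {A : Set (Fin k → M)} {σ : Fin k → Fin k}
    (hσ : Function.Injective σ) (h : (U.interiork ((fun v => v ∘ σ) '' A)).Nonempty) :
    (U.interiork A).Nonempty := by
  let e := Equiv.ofBijective σ (Finite.injective_iff_bijective.1 hσ)
  obtain ⟨x, c, hc, hx⟩ := h
  refine ⟨x ∘ e.symm, c, hc, fun y hy => ?_⟩
  obtain ⟨a, ha, hay⟩ := hx (show y ∘ σ ∈ U.ballk c x from fun i => by
    simpa [e] using hy (e i))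
  have hsurj : Function.Surjective σ := Finite.surjective_of_injective hσ
  rwa [← hsurj.injective_comp_right hay]

theorem bddAbove_topDim {k : ℕ} (A : Set (Fin k → M)) :
    BddAbove {l : ℕ | ∃ σ : Fin l → Fin k, Function.Injective σ ∧
      (U.interiork ((fun v => v ∘ σ) '' A)).Nonempty} :=
  ⟨k, fun _ ⟨σ, hσ, _⟩ => by simpa using Fintype.card_le_of_injective σ hσ⟩

theorem le_topDim_of_interiork_nonempty {k : ℕ} {A : Set (Fin k → M)}
    (h : (U.interiork A).Nonempty) : (k : WithBot ℕ) ≤ U.topDim A := by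
  rw [topDim, if_neg (h.mono (U.interiork_subset A)).ne_empty]
  refine WithBot.coe_le_coe.2 (le_csSup (U.bddAbove_topDim A) ⟨id, Function.injective_id, ?_⟩)
  simpa using h

theorem topDim_lt_of_interiork_eq_empty {k : ℕ} {A : Set (Fin k → M)}
    (h : ¬ (U.interiork A).Nonempty) : U.topDim A < (k : WithBot ℕ) := by
  rw [topDim]
  split_ifs with hA
  · exact WithBot.bot_lt_coe k
  · obtain ⟨a, ha⟩ := Set.nonempty_iff_ne_empty.2 hA
    obtain ⟨c, hc⟩ := U.dom_nonempty
    have hne : {l : ℕ | ∃ σ : Fin l → Fin k, Function.Injective σ ∧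
        (U.interiork ((fun v => v ∘ σ) '' A)).Nonempty}.Nonempty :=
      ⟨0, Fin.elim0, fun i => i.elim0, a ∘ Fin.elim0, c, hc,
        fun y _ => ⟨a, ha, Subsingleton.elim _ _⟩⟩
    have hmem := Nat.sSup_mem hne (U.bddAbove_topDim A)
    refine WithBot.coe_lt_coe.2 (lt_of_le_of_ne (csSup_le hne fun l ⟨σ, hσ, _⟩ => by
      simpa using Fintype.card_le_of_injective σ hσ) fun heq => ?_)
    rw [show sSup _ = k from heq] at hmem
    obtain ⟨σ, hσ, hint⟩ := hmem
    exact h (U.interiork_nonempty_of_image_comp hσ hint)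

end DefUniformBasis

/-- If `A ⊆ M^k` is definable, open (and nonempty) and is covered by definable
sets `A₁, …, A_n`, then some `Aᵢ` has nonempty interior in `A`; in fact almost every point of
`A` lies in the (relative) interior of some `Aᵢ`. -/
theorem statement16 (S : Setting L M) {k : ℕ} (A : Set (Fin k → M))
    (hAdef : DefSet L M A) (hAopen : S.toDefUniformBasis.IsOpenk A) (hAne : A.Nonempty)
    (n : ℕ) (P : Fin n → Set (Fin k → M)) (hPdef : ∀ i, DefSet L M (P i))
    (hcover : A ⊆ ⋃ i, P i) :
    (∃ i, (S.toDefUniformBasis.interiork (P i ∩ A)).Nonempty) ∧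
      S.toDefUniformBasis.topDim
          (A \ {p | ∃ i, p ∈ S.toDefUniformBasis.interiork (P i ∩ A)}) <
        S.toDefUniformBasis.topDim A := by
  have hAint : (S.interiork A).Nonempty := hAne.mono hAopen
  refine ⟨S.exists_interiork_inter_nonempty hAdef hAint hPdef hcover,
    (S.topDim_lt_of_interiork_eq_empty ?_).trans_le (S.le_topDim_of_interiork_nonempty hAint)⟩
  rintro ⟨p, c, hc, hp⟩
  obtain ⟨i, q, d, hd, hq⟩ := S.exists_interiork_inter_nonempty (S.defSet_ballk c p)
    ⟨p, c, hc, subset_rfl⟩ hPdef fun x hx => hcover (hp hx).1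
  exact (hp (hq (S.mem_ballk_self hd q)).2).2
    ⟨i, d, hd, fun y hy => ⟨(hq hy).1, (hp (hq hy).2).1⟩⟩

end DpTame
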